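/- Let a, b, λ be real numbers with ab ≠ 0 and a ≠ b, and set H = a + b and S = a² + b². If λ(a³ + b³) = S(S − 1), 1 + a(λ − H) = 0, and 2(1 + b(λ − H))(3b² + a²) = 3λa(a − b)², then a contradiction follows (no such real numbers exist). -/

import Mathlib

theorem stmt_5 (a b lam : ℝ) (hab : a * b ≠ 0) (hne : a ≠ b)
    (H : ℝ) (S : ℝ) (hH : H = a + b) (hS : S = a ^ 2 + b ^ 2)
    (h1 : lam * (a ^ 3 + b ^ 3) = S * (S - 1))
    (h2 : 1 + a * (lam - H) = 0)
    (h3 : 2 * (1 + b * (lam - H)) * (3 * b ^ 2 + a ^ 2) = 3 * lam * a * (a - b) ^ 2) :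
    False := by
  subst hH hS
  obtain ⟨ha, hb⟩ := mul_ne_zero_iff.mp hab
  have hd : a - b ≠ 0 := sub_ne_zero.mpr hne
  have hcubic : a ^ 2 * (a - b) + b = 0 := by
    apply mul_left_cancel₀ (mul_ne_zero hb hd)
    linear_combination a * h1 - (a ^ 3 + b ^ 3) * h2
  have hquad : 2 * (3 * b ^ 2 + a ^ 2) = 3 * a * (a - b) * (a ^ 2 + a * b - 1) := by
    apply mul_left_cancel₀ hd
    linear_combination a * h3 + (3 * a * (a - b) ^ 2 - 2 * b * (3 * b ^ 2 + a ^ 2)) * h2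
  have hsum : 5 * a ^ 2 + 9 * b ^ 2 = 0 := by
    linear_combination hquad + 3 * (a + b) * hcubic
  have : 0 < 5 * a ^ 2 + 9 * b ^ 2 := by positivity
  exact this.ne' hsum
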